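/- Let A be an N×N complex Hermitian matrix with eigenvalues λ₁ ≥ λ₂ ≥ ⋯ ≥ λ_N, and let λ̂₁ ≥ λ̂₂ ≥ ⋯ ≥ λ̂_N be real numbers satisfying the interlacing inequalities λ̂₁ ≥ λ₁ ≥ λ̂₂ ≥ λ₂ ≥ ⋯ ≥ λ̂_N ≥ λ_N. Then there exists a vector c ∈ ℂ^N such that the eigenvalues of A + cc* are exactly λ̂₁, …, λ̂_N (with multiplicity). -/

import Mathlib

open Polynomial

/-- Nonnegative weights realising the interlacing polynomial. -/
lemma exists_weights {ι : Type*} [LinearOrder ι] (lam lhat : ι → ℝ)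
    (h₁ : ∀ i, lam i ≤ lhat i) (h₂ : ∀ i j, i < j → lhat j ≤ lam i) (s : Finset ι) :
    ∃ w : ι → ℝ, (∀ i, 0 ≤ w i) ∧
      ∏ i ∈ s, (X - C (lhat i)) = ∏ i ∈ s, (X - C (lam i))
        - ∑ i ∈ s, C (w i) * ∏ j ∈ s.erase i, (X - C (lam j)) := by
  induction s using Finset.strongInduction with
  | H s ih =>
  by_cases hinj : Set.InjOn lam s
  · refine ⟨fun i => (lhat i - lam i) *
      ∏ j ∈ s.erase i, ((lam i - lhat j) / (lam i - lam j)), ?_, ?_⟩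
    · intro i
      refine mul_nonneg (sub_nonneg.2 (h₁ i)) (Finset.prod_nonneg fun j hj => ?_)
      rcases lt_or_gt_of_ne (Finset.ne_of_mem_erase hj) with h | h
      · have a := h₂ j i h
        have b := h₁ i
        have c := h₁ j
        exact div_nonneg_of_nonpos (by linarith) (by linarith)
      · have a := h₂ i j h
        have c := h₁ j
        exact div_nonneg (by linarith) (by linarith)
    · rw [← sub_eq_zero]
      have hlt : ∀ i ∈ s, (∏ j ∈ s.erase i, (X - C (lam j))).degree < (s.card : WithBot ℕ) := by
        intro i hi
        rw [degree_prod]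
        simp only [degree_X_sub_C, Finset.sum_const, nsmul_eq_mul, mul_one]
        exact_mod_cast Finset.card_erase_lt_of_mem hi
      have hdeg : ∀ f : ι → ℝ, (∏ i ∈ s, (X - C (f i))).degree = (s.card : WithBot ℕ) := by
        intro f
        rw [degree_prod]
        simp
      have hmon : ∀ f : ι → ℝ, (∏ i ∈ s, (X - C (f i))).Monic := fun f =>
        monic_prod_of_monic _ _ fun i _ => monic_X_sub_C _
      refine Polynomial.eq_zero_of_degree_lt_of_eval_index_eq_zero s hinj ?_ ?_
      · rw [← sub_add]
        refine lt_of_le_of_lt (degree_add_le _ _) (max_lt ?_ ?_)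
        · rw [← hdeg lhat]
          refine degree_sub_lt_left ?_ (hmon _).ne_zero ?_
          · rw [hdeg, hdeg]
          · rw [hmon lhat, hmon lam]
        · refine lt_of_le_of_lt (degree_sum_le _ _) ?_
          refine (Finset.sup_lt_iff (WithBot.bot_lt_coe _)).2 fun i hi => ?_
          rw [← smul_eq_C_mul]
          exact lt_of_le_of_lt (degree_smul_le _ _) (hlt i hi)
      · intro k hk
        simp only [eval_sub, eval_prod, eval_X, eval_C, eval_finsetSum, eval_mul]
        rw [Finset.prod_eq_zero (f := fun j => lam k - lam j) hk (sub_self _),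
          Finset.sum_eq_single_of_mem k hk]
        · rw [mul_assoc, ← Finset.prod_mul_distrib, ← Finset.mul_prod_erase s _ hk]
          have : ∏ j ∈ s.erase k, ((lam k - lhat j) / (lam k - lam j) * (lam k - lam j))
              = ∏ j ∈ s.erase k, (lam k - lhat j) := by
            refine Finset.prod_congr rfl fun j hj => ?_
            refine div_mul_cancel₀ _ (sub_ne_zero.2 fun h => ?_)
            exact Finset.ne_of_mem_erase hj (hinj (Finset.mem_of_mem_erase hj) hk h.symm)
          rw [this]
          ring
        · intro b hb hbk
          rw [Finset.prod_eq_zero (f := fun j => lam k - lam j) (i := k)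
            (Finset.mem_erase.2 ⟨hbk.symm, hk⟩) (sub_self _), mul_zero]
  · have : ∃ i j, i < j ∧ j ∈ s ∧ lam i = lam j := by
      simp only [Set.InjOn, not_forall] at hinj
      obtain ⟨a, ha, b, hb, hab, hne⟩ := hinj
      rcases lt_or_gt_of_ne hne with h | h
      · exact ⟨a, b, h, hb, hab⟩
      · exact ⟨b, a, h, ha, hab.symm⟩
    obtain ⟨i, j, hij, hj, he⟩ := this
    have hjj : lhat j = lam j := le_antisymm ((h₂ i j hij).trans he.le) (h₁ j)
    obtain ⟨w, hw, hP⟩ := ih (s.erase j) (Finset.erase_ssubset hj)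
    refine ⟨fun k => if k = j then 0 else w k, fun k => ?_, ?_⟩
    · dsimp only
      split_ifs
      · exact le_rfl
      · exact hw k
    · rw [← Finset.mul_prod_erase s _ hj, ← Finset.mul_prod_erase s (fun i => X - C (lam i)) hj,
        ← Finset.add_sum_erase s _ hj, hP, hjj, mul_sub, Finset.mul_sum]
      simp only [if_true, C_0, zero_mul, zero_add]
      congr 1
      refine Finset.sum_congr rfl fun k hk => ?_
      have hkj := Finset.ne_of_mem_erase hk
      rw [if_neg hkj, ← Finset.mul_prod_erase (s.erase k) (fun i => X - C (lam i))
        (Finset.mem_erase.2 ⟨hkj.symm, hj⟩), Finset.erase_right_comm]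
      ring

lemma charpoly_diag_add {N : ℕ} (d u v : Fin N → ℂ) :
    (Matrix.diagonal d + Matrix.vecMulVec u v).charpoly = ∏ i, (X - C (d i))
      - ∑ i, C (u i * v i) * ∏ j ∈ Finset.univ.erase i, (X - C (d j)) := by
  refine Polynomial.eq_of_infinite_eval_eq _ _
    (Set.Infinite.mono ?_ (Set.finite_range d).infinite_compl)
  intro z hz
  have hne : ∀ i, z - d i ≠ 0 := fun i h => hz ⟨i, (sub_eq_zero.1 h).symm⟩
  have hfac : Matrix.scalar (Fin N) z - (Matrix.diagonal d + Matrix.vecMulVec u v)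
      = Matrix.diagonal (fun i => z - d i) *
        (1 + Matrix.replicateCol Unit (fun i => - u i / (z - d i)) * Matrix.replicateRow Unit v) := by
    ext i j
    rw [Matrix.diagonal_mul]
    have := hne i
    by_cases hij : i = j
    · subst hij
      simp [Matrix.vecMulVec_apply, Matrix.mul_apply]
      field_simp
      ring
    · simp [Matrix.vecMulVec_apply, Matrix.mul_apply, hij]
      field_simp
  show eval z _ = eval z _
  rw [Matrix.eval_charpoly, hfac, Matrix.det_mul, Matrix.det_diagonal,
    Matrix.det_one_add_replicateCol_mul_replicateRow]
  simp only [eval_sub, eval_prod, eval_X, eval_C, eval_finsetSum, eval_mul, dotProduct]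
  rw [mul_add, mul_one, sub_eq_add_neg, ← Finset.sum_neg_distrib, Finset.mul_sum]
  congr 1
  refine Finset.sum_congr rfl fun i _ => ?_
  rw [← Finset.mul_prod_erase Finset.univ _ (Finset.mem_univ i)]
  have := hne i
  field_simp

/-- Converse to Weyl's interlacing theorem: given a Hermitian matrix `A` with
eigenvalues `lam` (decreasing, with multiplicity, encoded via the characteristic
polynomial) and reals `lhat` interlacing `lam`, there is a rank-one perturbation
`A + c c*` whose eigenvalues are exactly `lhat`. -/
theorem converse_weyl_complex (N : ℕ) (A : Matrix (Fin N) (Fin N) ℂ)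
    (hA : A.IsHermitian) (lam lhat : Fin N → ℝ)
    (hcp : A.charpoly = ∏ i : Fin N, (X - C ((lam i : ℂ))))
    (hlam : Antitone lam) (hlhat : Antitone lhat)
    (h₁ : ∀ i : Fin N, lam i ≤ lhat i)
    (h₂ : ∀ i j : Fin N, (i : ℕ) + 1 = (j : ℕ) → lhat j ≤ lam i) :
    ∃ c : Fin N → ℂ,
      (A + Matrix.vecMulVec c (star c)).charpoly
        = ∏ i : Fin N, (X - C ((lhat i : ℂ))) := by
  have h₂' : ∀ i j : Fin N, i < j → lhat j ≤ lam i := by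
    intro i j hij
    have hb : (i : ℕ) + 1 < N := by have := j.2; have : (i : ℕ) < j := hij; omega
    have hle : (⟨i + 1, hb⟩ : Fin N) ≤ j := by
      have : (i : ℕ) < j := hij
      exact this
    exact (hlhat hle).trans (h₂ i ⟨i + 1, hb⟩ rfl)
  obtain ⟨w, hw, hP⟩ := exists_weights lam lhat h₁ h₂' Finset.univ
  have hPC := congrArg (Polynomial.map Complex.ofRealHom) hP
  simp only [Polynomial.map_sub, Polynomial.map_prod, Polynomial.map_sum, Polynomial.map_mul,
    Polynomial.map_X, Polynomial.map_C, Complex.ofRealHom_eq_coe] at hPC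
  set D : Matrix (Fin N) (Fin N) ℂ := Matrix.diagonal (fun i => (lam i : ℂ)) with hD
  have hDh : D.IsHermitian := by
    rw [hD, Matrix.isHermitian_diagonal_iff]
    intro i
    simp [IsSelfAdjoint]
  have hev : hA.eigenvalues = hDh.eigenvalues := by
    rw [Matrix.IsHermitian.eigenvalues_eq_eigenvalues_iff, hcp, hD, Matrix.charpoly_diagonal]
  have hexU : ∃ U : Matrix.unitaryGroup (Fin N) ℂ,
      A = (U : Matrix (Fin N) (Fin N) ℂ) * D * star (U : Matrix (Fin N) (Fin N) ℂ) := by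
    refine ⟨hA.eigenvectorUnitary * star hDh.eigenvectorUnitary, ?_⟩
    have e1 := hA.spectral_theorem
    have e2 := hDh.conjStarAlgAut_star_eigenvectorUnitary
    rw [hev, ← e2] at e1
    rw [Unitary.conjStarAlgAut_apply, Unitary.conjStarAlgAut_star_apply] at e1
    refine e1.trans ?_
    simp [mul_assoc]
  obtain ⟨U, hU⟩ := hexU
  set c' : Fin N → ℂ := fun i => ((Real.sqrt (w i) : ℝ) : ℂ) with hc'
  refine ⟨(U : Matrix (Fin N) (Fin N) ℂ).mulVec c', ?_⟩
  have hconj : A + Matrix.vecMulVec ((U : Matrix (Fin N) (Fin N) ℂ).mulVec c')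
      (star ((U : Matrix (Fin N) (Fin N) ℂ).mulVec c')) =
      (U : Matrix (Fin N) (Fin N) ℂ) * ((D + Matrix.vecMulVec c' (star c')) *
        star (U : Matrix (Fin N) (Fin N) ℂ)) := by
    rw [Matrix.star_mulVec, ← Matrix.mul_vecMulVec, ← Matrix.vecMulVec_mul]
    conv_lhs => rw [hU]
    rw [add_mul, mul_add, mul_assoc, ← Matrix.star_eq_conjTranspose]
  rw [hconj, Matrix.charpoly_mul_comm, mul_assoc, Unitary.coe_star_mul_self, mul_one, hD,
    charpoly_diag_add, hPC]
  congr 1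
  refine Finset.sum_congr rfl fun i _ => ?_
  congr 2
  simp only [hc', Pi.star_apply, RCLike.star_def, Complex.conj_ofReal]
  rw [← Complex.ofReal_mul, Real.mul_self_sqrt (hw i)]
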